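/- Let 1 < p < ∞ and 1 < q < ∞. Then there exists a measurable function f on ℝ² such that f is not essentially bounded, f(x,y) = f(y,x), almost every section f_x and f_y belongs to Lip(1/p), and the functions y ↦ ‖f_y‖_{Lip 1/p} and x ↦ ‖f_x‖_{Lip 1/p} belong to the Lorentz space L^{p,q}(ℝ). In other words, in the limiting continuity theorem the exterior L^{p,1}-norm cannot be replaced by the weaker Lorentz norm L^{p,q} with q > 1. -/

import Mathlib

open MeasureTheory Set
open scoped ENNReal

noncomputable section

/-- Extended essential sup norm on ℝ. -/
def einf (φ : ℝ → ℝ) : ℝ≥0∞ := eLpNorm φ ⊤ volume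

/-- Lipschitz `α` seminorm (extended real valued):
`sup_{h>0} h^{-α} ‖φ(·+h) - φ‖_∞`. -/
def lipSemiE (α : ℝ) (φ : ℝ → ℝ) : ℝ≥0∞ :=
  ⨆ h ∈ Ioi (0:ℝ), ENNReal.ofReal (h ^ (-α)) * einf (fun x => φ (x + h) - φ x)

/-- Real-valued Lipschitz `α` seminorm `‖φ‖*_{Lip α}`. -/
def lipSemi (α : ℝ) (φ : ℝ → ℝ) : ℝ := (lipSemiE α φ).toReal

/-- `φ ∈ Lip α`: essentially bounded with finite Lipschitz `α` seminorm. -/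
def MemLip (α : ℝ) (φ : ℝ → ℝ) : Prop := einf φ < ⊤ ∧ lipSemiE α φ < ⊤

/-- `‖φ‖_{Lip α} = ‖φ‖_∞ + ‖φ‖*_{Lip α}`. -/
def lipNorm (α : ℝ) (φ : ℝ → ℝ) : ℝ := (einf φ + lipSemiE α φ).toReal

/-- The class `S₀`: measurable functions with finite distribution function at every
positive level. -/
def S0 {X : Type*} [MeasureSpace X] (f : X → ℝ) : Prop :=
  Measurable f ∧ ∀ s : ℝ, 0 < s → volume {x | s < |f x|} < ⊤

/-- The non-increasing rearrangement `f*`. -/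
def rearr {X : Type*} [MeasureSpace X] (f : X → ℝ) (t : ℝ) : ℝ :=
  sInf {s : ℝ | 0 ≤ s ∧ volume {x | s < |f x|} ≤ ENNReal.ofReal t}

/-- `f**(t) = (1/t) ∫₀^t f*(u) du`. -/
def doubleStar {X : Type*} [MeasureSpace X] (f : X → ℝ) (t : ℝ) : ℝ :=
  (∫ u in Ioc (0:ℝ) t, rearr f u) / t

/-- Lorentz `L^{p,q}` norm. -/
def lorentzNorm {X : Type*} [MeasureSpace X] (p q : ℝ) (f : X → ℝ) : ℝ :=
  (∫ t in Ioi (0:ℝ), (t ^ (1/p) * rearr f t) ^ q / t) ^ (1/q)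

/-- Membership in the Lorentz space `L^{p,q}`. -/
def MemLorentz {X : Type*} [MeasureSpace X] (p q : ℝ) (f : X → ℝ) : Prop :=
  S0 f ∧ IntegrableOn (fun t => (t ^ (1/p) * rearr f t) ^ q / t) (Ioi (0:ℝ))

/-- The space `U_p(ℝ²)`: a.e. sections in `Lip (1/p)`, with `Lip (1/p)` norms of the
sections in `L^{p,1}(ℝ)`. -/
def MemUp (p : ℝ) (f : ℝ × ℝ → ℝ) : Prop :=
  Measurable f ∧
  (∀ᵐ y : ℝ ∂volume, MemLip (1/p) (fun x => f (x, y))) ∧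
  (∀ᵐ x : ℝ ∂volume, MemLip (1/p) (fun y => f (x, y))) ∧
  MemLorentz p 1 (fun y => lipNorm (1/p) (fun x => f (x, y))) ∧
  MemLorentz p 1 (fun x => lipNorm (1/p) (fun y => f (x, y)))

/-- The Steklov-type average `f_h`. -/
def avg (f : ℝ × ℝ → ℝ) (h : ℝ) (z : ℝ × ℝ) : ℝ :=
  (∫ u in Ioc (0:ℝ) h, ∫ v in Ioc (0:ℝ) h, f (z.1 + u, z.2 + v)) / h ^ 2

/-- The profile `x ↦ log (1 + log⁺ (1 / |x|))`, with value `0` at the origin. -/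
def logLogProfile (x : ℝ) : ℝ := Real.log (1 - Real.log (min |x| 1))

lemma measurable_logLogProfile : Measurable logLogProfile := by
  unfold logLogProfile
  fun_prop

lemma one_le_one_sub_log {r : ℝ} (h0 : 0 ≤ r) (h1 : r ≤ 1) : 1 ≤ 1 - Real.log r := by
  linarith [Real.log_nonpos h0 h1]

lemma logLogProfile_nonneg (x : ℝ) : 0 ≤ logLogProfile x :=
  Real.log_nonneg (one_le_one_sub_log (by positivity) (min_le_right _ _))

lemma logLogProfile_eq_zero {x : ℝ} (hx : 1 ≤ |x|) : logLogProfile x = 0 := by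
  simp [logLogProfile, min_eq_right hx]

lemma log_one_sub_log_anti {a b : ℝ} (ha : 0 < a) (hab : a ≤ b) (hb : b ≤ 1) :
    Real.log (1 - Real.log b) ≤ Real.log (1 - Real.log a) := by
  have := one_le_one_sub_log (ha.le.trans hab) hb
  have := Real.log_le_log ha hab
  exact Real.log_le_log (by linarith) (by linarith)

lemma logLogProfile_anti {x y : ℝ} (hx : x ≠ 0) (hxy : |x| ≤ |y|) :
    logLogProfile y ≤ logLogProfile x :=
  log_one_sub_log_anti (lt_min (abs_pos.2 hx) one_pos) (min_le_min_right _ hxy) (min_le_right _ _)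

lemma abs_rpow_sub_rpow_le {α : ℝ} (hα : 0 ≤ α) (hα1 : α ≤ 1) {a b : ℝ} (ha : 0 ≤ a)
    (hab : a ≤ b) : b ^ α - a ^ α ≤ (b - a) ^ α := by
  have := Real.rpow_add_le_add_rpow ha (sub_nonneg.2 hab) hα hα1
  rw [add_sub_cancel] at this
  linarith

/-- The Lipschitz constant of the profile truncated at height `logLogProfile r`. -/
def holderConst (p r : ℝ) : ℝ := p * (1 + p) * (r ^ (-(1/p)) / (1 - Real.log r))

lemma holderConst_nonneg {p r : ℝ} (hp : 1 < p) (hr : 0 < r) (hr1 : r ≤ 1) :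
    0 ≤ holderConst p r := by
  have := one_le_one_sub_log hr.le hr1
  unfold holderConst
  positivity

/-- Slow variation of `s ↦ 1 - log s`. -/
lemma one_sub_log_le {p r s : ℝ} (hp : 1 < p) (hr : 0 < r) (hrs : r ≤ s) (hs : s ≤ 1) :
    1 - Real.log r ≤ (1 + p) * (s / r) ^ (1/p) * (1 - Real.log s) := by
  have hs0 : 0 < s := hr.trans_le hrs
  have h1 := one_le_one_sub_log hs0.le hs
  have hu : 1 ≤ s / r := (one_le_div hr).2 hrs
  have hα : 0 < 1 / p := by positivity
  have h2 := Real.log_le_rpow_div (zero_le_one.trans hu) hα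
  have h3 : 1 ≤ (s / r) ^ (1/p) := Real.one_le_rpow hu hα.le
  rw [Real.log_div hs0.ne' hr.ne', div_div_eq_mul_div, div_one] at h2
  set w := (s / r) ^ (1/p)
  have h4 : 0 ≤ w * p := by positivity
  nlinarith

lemma log_one_sub_log_sub_le {p r a b : ℝ} (hp : 1 < p) (hr : 0 < r) (hra : r ≤ a) (hab : a ≤ b)
    (hb : b ≤ 1) :
    Real.log (1 - Real.log a) - Real.log (1 - Real.log b) ≤ holderConst p r * (b - a) ^ (1/p) := by
  have hp0 : 0 < p := by linarith
  set K := holderConst p r with hK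
  have hK0 : 0 ≤ K := holderConst_nonneg hp hr (hra.trans (hab.trans hb))
  have hder : ∀ s ∈ Icc r 1, HasDerivAt (fun s => K * s ^ (1/p) + Real.log (1 - Real.log s))
      (K * ((1/p) * s ^ (1/p - 1)) + -(s⁻¹) / (1 - Real.log s)) s := by
    intro s hs
    have hs0 : 0 < s := hr.trans_le hs.1
    have h1 := one_le_one_sub_log hs0.le hs.2
    exact ((Real.hasDerivAt_rpow_const (Or.inl hs0.ne')).const_mul K).add
      (((Real.hasDerivAt_log hs0.ne').const_sub 1).log (by linarith))
  have hmono : MonotoneOn (fun s => K * s ^ (1/p) + Real.log (1 - Real.log s)) (Icc r 1) := by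
    refine monotoneOn_of_deriv_nonneg (convex_Icc r 1)
      (fun s hs => (hder s hs).continuousAt.continuousWithinAt)
      (fun s hs => (hder s (interior_subset hs)).differentiableAt.differentiableWithinAt) ?_
    intro s hs
    have hs := interior_subset hs
    rw [(hder s hs).deriv]
    have hs0 : 0 < s := hr.trans_le hs.1
    have h1 := one_le_one_sub_log hs0.le hs.2
    have h2 := one_le_one_sub_log hr.le (hs.1.trans hs.2)
    have h3 := one_sub_log_le hp hr hs.1 hs.2
    rw [Real.div_rpow hs0.le hr.le] at h3
    have hrp : 0 < r ^ (1/p) := by positivity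
    have key : s⁻¹ / (1 - Real.log s) ≤ K * ((1/p) * s ^ (1/p - 1)) := by
      rw [hK, holderConst, Real.rpow_neg hr.le, Real.rpow_sub_one hs0.ne']
      rw [div_le_iff₀ (by linarith)]
      have : p * (1 + p) * ((r ^ (1/p))⁻¹ / (1 - Real.log r)) * (1 / p * (s ^ (1/p) / s))
          * (1 - Real.log s)
          = s⁻¹ * (((1 + p) * (s ^ (1/p) / r ^ (1/p)) * (1 - Real.log s)) / (1 - Real.log r)) := by
        have : 1 - Real.log r ≠ 0 := by linarith
        field_simp
      rw [this]
      refine le_mul_of_one_le_right (by positivity) ?_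
      rwa [one_le_div (by linarith)]
    rw [neg_div]
    linarith
  have h := hmono ⟨hra, hab.trans hb⟩ ⟨hra.trans hab, hb⟩ hab
  have h2 := mul_le_mul_of_nonneg_left (abs_rpow_sub_rpow_le (α := 1/p) (by positivity)
    ((div_le_one hp0).2 hp.le) (hr.le.trans hra) hab) hK0
  simp only at h
  nlinarith

lemma abs_log_one_sub_log_sub_le {p r a b : ℝ} (hp : 1 < p) (hr : 0 < r) (hra : r ≤ a)
    (hrb : r ≤ b) (ha : a ≤ 1) (hb : b ≤ 1) :
    |Real.log (1 - Real.log a) - Real.log (1 - Real.log b)|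
      ≤ holderConst p r * |a - b| ^ (1/p) := by
  wlog hab : a ≤ b generalizing a b
  · rw [abs_sub_comm, abs_sub_comm a]
    exact this hrb hra hb ha (le_of_not_ge hab)
  rw [abs_of_nonneg (sub_nonneg.2 (log_one_sub_log_anti (hr.trans_le hra) hab hb)),
    abs_of_nonpos (sub_nonpos.2 hab), neg_sub]
  exact log_one_sub_log_sub_le hp hr hra hab hb

lemma min_logLogProfile {x y : ℝ} (hx : x ≠ 0) (hy : y ≠ 0) :
    min (logLogProfile x) (logLogProfile y)
      = Real.log (1 - Real.log (max (min |x| 1) (min |y| 1))) := by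
  rcases le_total |x| |y| with h | h
  · rw [min_eq_right (logLogProfile_anti hx h), max_eq_right (min_le_min_right _ h),
      logLogProfile]
  · rw [min_eq_left (logLogProfile_anti hy h), max_eq_left (min_le_min_right _ h),
      logLogProfile]

lemma abs_min_logLogProfile_sub_le {p x x' y : ℝ} (hp : 1 < p) (hx : x ≠ 0) (hx' : x' ≠ 0)
    (hy : y ≠ 0) :
    |min (logLogProfile x') (logLogProfile y) - min (logLogProfile x) (logLogProfile y)|
      ≤ holderConst p (min |y| 1) * |x' - x| ^ (1/p) := by
  have hr : 0 < min |y| 1 := lt_min (abs_pos.2 hy) one_pos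
  rw [min_logLogProfile hx hy, min_logLogProfile hx' hy]
  refine (abs_log_one_sub_log_sub_le hp hr (le_max_right _ _) (le_max_right _ _)
    (max_le (min_le_right _ _) (min_le_right _ _))
    (max_le (min_le_right _ _) (min_le_right _ _))).trans ?_
  have hK := holderConst_nonneg hp hr (min_le_right _ _)
  have h : |max (min |x'| 1) (min |y| 1) - max (min |x| 1) (min |y| 1)| ≤ |x' - x| :=
    (abs_max_sub_max_le_abs _ _ _).trans
      ((abs_inf_sub_inf_le_abs _ _ _).trans (abs_abs_sub_abs_le x' x))
  gcongr

lemma logLogProfile_le {p y : ℝ} (hp : 1 < p) (hy : y ≠ 0) :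
    logLogProfile y ≤ holderConst p (min |y| 1) := by
  have hr : 0 < min |y| 1 := lt_min (abs_pos.2 hy) one_pos
  have h := log_one_sub_log_sub_le hp hr le_rfl (min_le_right _ _) le_rfl
  rw [Real.log_one, sub_zero, Real.log_one, sub_zero] at h
  refine h.trans (mul_le_of_le_one_right (holderConst_nonneg hp hr (min_le_right _ _)) ?_)
  exact Real.rpow_le_one (sub_nonneg.2 (min_le_right _ _)) (by linarith) (by positivity)

lemma abs_min_sub_min_le_of_le {a b c c' : ℝ} (h : c ≤ c') :
    |min a c - min b c| ≤ |min a c' - min b c'| := by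
  have key : ∀ a : ℝ, min a c = min (min a c') c := fun a => by rw [min_assoc, min_eq_right h]
  rw [key a, key b]
  exact abs_inf_sub_inf_le_abs _ _ _

lemma einf_le_of_ae_bound {φ : ℝ → ℝ} {C : ℝ} (h : ∀ᵐ x, |φ x| ≤ C) :
    einf φ ≤ ENNReal.ofReal C := by
  rw [einf, eLpNorm_exponent_top]
  exact eLpNormEssSup_le_of_ae_bound h

lemma einf_mono {φ ψ : ℝ → ℝ} (h : ∀ x, |φ x| ≤ |ψ x|) : einf φ ≤ einf ψ := eLpNorm_mono h

/-- The extended `Lip α` norm of the profile truncated at height `c`. -/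
def truncNorm (α c : ℝ) : ℝ≥0∞ :=
  einf (fun x => min (logLogProfile x) c) + lipSemiE α (fun x => min (logLogProfile x) c)

lemma truncNorm_mono (α : ℝ) {c c' : ℝ} (hc : 0 ≤ c) (h : c ≤ c') :
    truncNorm α c ≤ truncNorm α c' := by
  refine add_le_add (einf_mono fun x => ?_) (iSup₂_mono fun t _ => ?_)
  · rw [abs_of_nonneg (le_min (logLogProfile_nonneg x) hc),
      abs_of_nonneg (le_min (logLogProfile_nonneg x) (hc.trans h))]
    exact min_le_min_left _ h
  · gcongr
    exact einf_mono fun x => abs_min_sub_min_le_of_le h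

lemma measurable_truncNorm_comp (α : ℝ) : Measurable fun y => truncNorm α (logLogProfile y) := by
  have h : Monotone fun c : ℝ => truncNorm α (max c 0) := fun c c' hcc =>
    truncNorm_mono α (le_max_right _ _) (max_le_max_right _ hcc)
  simpa only [Function.comp_def, max_eq_left (logLogProfile_nonneg _)]
    using h.measurable.comp measurable_logLogProfile

lemma truncNorm_zero (α : ℝ) : truncNorm α 0 = 0 := by
  have h (x : ℝ) : min (logLogProfile x) 0 = 0 := min_eq_right (logLogProfile_nonneg x)
  have h0 : einf (fun _ => 0) = 0 := eLpNorm_zero'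
  simp [truncNorm, lipSemiE, h, h0]

lemma einf_trunc_le {p y : ℝ} (hp : 1 < p) (hy : y ≠ 0) :
    einf (fun x => min (logLogProfile x) (logLogProfile y))
      ≤ ENNReal.ofReal (holderConst p (min |y| 1)) := by
  refine einf_le_of_ae_bound (.of_forall fun x => ?_)
  rw [abs_of_nonneg (le_min (logLogProfile_nonneg x) (logLogProfile_nonneg y))]
  exact (min_le_right _ _).trans (logLogProfile_le hp hy)

lemma lipSemiE_trunc_le {p y : ℝ} (hp : 1 < p) (hy : y ≠ 0) :
    lipSemiE (1/p) (fun x => min (logLogProfile x) (logLogProfile y))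
      ≤ ENNReal.ofReal (holderConst p (min |y| 1)) := by
  refine iSup₂_le fun t (ht : 0 < t) => ?_
  have h : einf (fun x => min (logLogProfile (x + t)) (logLogProfile y)
      - min (logLogProfile x) (logLogProfile y))
      ≤ ENNReal.ofReal (holderConst p (min |y| 1) * t ^ (1/p)) := by
    refine einf_le_of_ae_bound ?_
    filter_upwards [volume.ae_ne (0:ℝ), volume.ae_ne (-t)] with x hx hx'
    have := abs_min_logLogProfile_sub_le (x := x) (x' := x + t) hp hx
      (fun h => hx' (by linarith)) hy
    rwa [add_sub_cancel_left, abs_of_pos ht] at this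
  refine (mul_le_mul_right h _).trans ?_
  rw [← ENNReal.ofReal_mul (by positivity), Real.rpow_neg ht.le]
  refine ENNReal.ofReal_le_ofReal (le_of_eq ?_)
  have : 0 < t ^ (1/p) := by positivity
  field_simp

lemma memLip_trunc {p y : ℝ} (hp : 1 < p) (hy : y ≠ 0) :
    MemLip (1/p) (fun x => min (logLogProfile x) (logLogProfile y)) :=
  ⟨(einf_trunc_le hp hy).trans_lt ENNReal.ofReal_lt_top,
    (lipSemiE_trunc_le hp hy).trans_lt ENNReal.ofReal_lt_top⟩

/-- The `Lip (1/p)` norm of the section at `y` of `min (G x) (G y)`, with `G` the profile. -/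
def sectionNorm (p y : ℝ) : ℝ := lipNorm (1/p) (fun x => min (logLogProfile x) (logLogProfile y))

lemma sectionNorm_eq (p y : ℝ) :
    sectionNorm p y = (truncNorm (1/p) (logLogProfile y)).toReal := rfl

lemma measurable_sectionNorm (p : ℝ) : Measurable (sectionNorm p) :=
  (measurable_truncNorm_comp (1/p)).ennreal_toReal

lemma sectionNorm_nonneg (p y : ℝ) : 0 ≤ sectionNorm p y := ENNReal.toReal_nonneg

lemma sectionNorm_eq_zero (p : ℝ) {y : ℝ} (hy : 1 ≤ |y|) : sectionNorm p y = 0 := by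
  rw [sectionNorm_eq, logLogProfile_eq_zero hy, truncNorm_zero, ENNReal.toReal_zero]

lemma sectionNorm_anti {p x y : ℝ} (hp : 1 < p) (hx : x ≠ 0) (hxy : |x| ≤ |y|) :
    sectionNorm p y ≤ sectionNorm p x :=
  ENNReal.toReal_mono (ENNReal.add_lt_top.2 (memLip_trunc hp hx)).ne
    (truncNorm_mono _ (logLogProfile_nonneg y) (logLogProfile_anti hx hxy))

lemma sectionNorm_le {p y : ℝ} (hp : 1 < p) (hy : y ≠ 0) :
    sectionNorm p y ≤ 2 * holderConst p (min |y| 1) := by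
  have hK := holderConst_nonneg hp (lt_min (abs_pos.2 hy) one_pos) (min_le_right |y| 1)
  refine ENNReal.toReal_le_of_le_ofReal (by positivity) ?_
  rw [two_mul, ENNReal.ofReal_add hK hK]
  exact add_le_add (einf_trunc_le hp hy) (lipSemiE_trunc_le hp hy)

lemma volume_sectionNorm_lt {p s r : ℝ} (hp : 1 < p) (hr : 0 < r) (hs : sectionNorm p r ≤ s) :
    volume {y | s < |sectionNorm p y|} ≤ ENNReal.ofReal (2 * r) := by
  have h : {y | s < |sectionNorm p y|} ⊆ Icc (-r) r := by
    intro y hy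
    rw [mem_ofPred_eq, abs_of_nonneg (sectionNorm_nonneg p y)] at hy
    refine abs_le.1 (le_of_not_gt fun h => ?_)
    have := sectionNorm_anti (p := p) hp hr.ne' ((abs_of_pos hr).trans_le h.le)
    linarith
  refine (measure_mono h).trans ?_
  rw [Real.volume_Icc]
  exact ENNReal.ofReal_le_ofReal (by linarith)

lemma rearr_sectionNorm_mem {p t : ℝ} (hp : 1 < p) (ht : 0 < t) :
    sectionNorm p (t/2) ∈ {s : ℝ | 0 ≤ s ∧
      volume {x | s < |sectionNorm p x|} ≤ ENNReal.ofReal t} := by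
  refine ⟨sectionNorm_nonneg _ _, ?_⟩
  have := volume_sectionNorm_lt hp (half_pos ht) le_rfl
  rwa [mul_div_cancel₀ t two_ne_zero] at this

lemma rearr_nonneg (f : ℝ → ℝ) (t : ℝ) : 0 ≤ rearr f t := Real.sInf_nonneg fun _ h => h.1

lemma rearr_sectionNorm_le {p t : ℝ} (hp : 1 < p) (ht : 0 < t) :
    rearr (sectionNorm p) t ≤ sectionNorm p (t/2) :=
  csInf_le ⟨0, fun _ h => h.1⟩ (rearr_sectionNorm_mem hp ht)

lemma rearr_sectionNorm_anti {p : ℝ} (hp : 1 < p) :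
    AntitoneOn (rearr (sectionNorm p)) (Ioi 0) := by
  intro t ht t' _ htt
  exact csInf_le_csInf ⟨0, fun _ h => h.1⟩ ⟨_, rearr_sectionNorm_mem hp ht⟩
    fun s hs => ⟨hs.1, hs.2.trans (ENNReal.ofReal_le_ofReal htt)⟩

lemma S0_sectionNorm {p : ℝ} (hp : 1 < p) : S0 (sectionNorm p) := by
  refine ⟨measurable_sectionNorm p, fun s hs => ?_⟩
  refine (volume_sectionNorm_lt hp one_pos ?_).trans_lt ENNReal.ofReal_lt_top
  rw [sectionNorm_eq_zero p (by simp)]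
  exact hs.le

lemma integrableOn_log_rpow_div {q : ℝ} (hq : 1 < q) :
    IntegrableOn (fun t => (1 - Real.log (t/2)) ^ (-q) / t) (Ioc (0:ℝ) 2) := by
  have hpos : ∀ t ∈ Ioc (0:ℝ) 2, 0 < 1 - Real.log (t/2) := fun t ht => by
    linarith [one_le_one_sub_log (r := t/2) (by linarith [ht.1]) (by linarith [ht.2])]
  have hder : ∀ t ∈ Ioc (0:ℝ) 2,
      HasDerivAt (fun t => (1 - Real.log (t/2)) ^ (1 - q) / (q - 1))
        ((1 - Real.log (t/2)) ^ (-q) / t) t := by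
    intro t ht
    have ht0 := ht.1
    have h := ((((hasDerivAt_id t).div_const 2).log (by simp [ht0.ne'])).const_sub 1).rpow_const
      (p := 1 - q) (Or.inl (hpos t ht).ne')
    have h2 := h.div_const (q - 1)
    refine h2.congr_deriv ?_
    have : q - 1 ≠ 0 := by linarith
    simp only [id]
    rw [show 1 - q - 1 = -q by ring]
    field_simp
    ring
  have hev : ∀ t, 0 < t → (fun t => if t ≤ 0 then 0 else (1 - Real.log (t/2)) ^ (1 - q) / (q - 1))
      =ᶠ[nhds t] fun t => (1 - Real.log (t/2)) ^ (1 - q) / (q - 1) := by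
    intro t ht
    filter_upwards [Ioi_mem_nhds ht] with s hs
    rw [if_neg (not_le.2 hs)]
  refine intervalIntegral.integrableOn_deriv_of_nonneg
    (g := fun t => if t ≤ 0 then 0 else (1 - Real.log (t/2)) ^ (1 - q) / (q - 1)) ?_
    (fun t ht => (hder t (Ioo_subset_Ioc_self ht)).congr_of_eventuallyEq (hev t ht.1))
    fun t ht => div_nonneg (Real.rpow_nonneg (hpos t (Ioo_subset_Ioc_self ht)).le _) ht.1.le
  intro t ht
  rcases ht.1.eq_or_lt with rfl | h0
  · refine ContinuousAt.continuousWithinAt ?_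
    rw [continuousAt_iff_continuous_left'_right']
    constructor
    · refine (tendsto_const_nhds (x := (0:ℝ))).congr' ?_ |>.trans (by simp)
      filter_upwards [self_mem_nhdsWithin] with s hs
      rw [if_pos (le_of_lt hs)]
    · have h1 : Filter.Tendsto (fun t : ℝ => t/2) (nhdsWithin 0 (Ioi 0)) (nhdsWithin 0 (Ioi 0)) := by
        refine tendsto_nhdsWithin_iff.2 ⟨?_, ?_⟩
        · exact (Continuous.tendsto' (by fun_prop) 0 0 (by simp)).mono_left nhdsWithin_le_nhds
        · filter_upwards [self_mem_nhdsWithin] with s hs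
          exact half_pos (mem_Ioi.1 hs)
      have h2 : Filter.Tendsto (fun t : ℝ => 1 - Real.log (t/2)) (nhdsWithin 0 (Ioi 0))
          Filter.atTop :=
        Filter.tendsto_atTop_add_const_left _ 1
          (Filter.tendsto_neg_atBot_atTop.comp (Real.tendsto_log_nhdsGT_zero.comp h1))
      have h3 := ((tendsto_rpow_neg_atTop (sub_pos.2 hq)).comp h2).div_const (q - 1)
      rw [ContinuousWithinAt, if_pos le_rfl]
      rw [zero_div] at h3
      refine h3.congr' ?_
      filter_upwards [self_mem_nhdsWithin] with s hs
      rw [if_neg (not_le.2 hs), Function.comp_apply, neg_sub]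
  · exact ((hder t ⟨h0, ht.2⟩).continuousAt.congr (hev t h0).symm).continuousWithinAt

lemma rpow_mul_rearr_sectionNorm_le {p t : ℝ} (hp : 1 < p) (ht : t ∈ Ioc (0:ℝ) 2) :
    t ^ (1/p) * rearr (sectionNorm p) t
      ≤ 2 * (p * (1 + p)) * 2 ^ (1/p) * (1 - Real.log (t/2))⁻¹ := by
  have ht0 := ht.1
  have h := (rearr_sectionNorm_le hp ht0).trans (sectionNorm_le hp (half_pos ht0).ne')
  rw [abs_of_pos (half_pos ht0), min_eq_left (by linarith [ht.2]), holderConst,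
    Real.rpow_neg (by positivity), Real.div_rpow ht0.le two_pos.le] at h
  refine (mul_le_mul_of_nonneg_left h (by positivity)).trans (le_of_eq ?_)
  have : 0 < t ^ (1/p) := by positivity
  rw [inv_div, div_eq_mul_inv _ (1 - Real.log (t/2))]
  field_simp

lemma memLorentz_sectionNorm {p q : ℝ} (hp : 1 < p) (hq : 1 < q) :
    MemLorentz p q (sectionNorm p) := by
  refine ⟨S0_sectionNorm hp, ?_⟩
  have hzero : ∀ t ∈ Ioi (0:ℝ) \ Ioc 0 2,
      (t ^ (1/p) * rearr (sectionNorm p) t) ^ q / t = 0 := by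
    intro t ht
    have ht0 : 0 < t := ht.1
    have ht2 : 2 < t := by
      by_contra h
      exact ht.2 ⟨ht0, not_lt.1 h⟩
    have h := rearr_sectionNorm_le hp ht0
    rw [sectionNorm_eq_zero p (by rw [abs_of_pos (half_pos ht0)]; linarith)] at h
    rw [le_antisymm h (rearr_nonneg _ _), mul_zero, Real.zero_rpow (by linarith), zero_div]
  refine IntegrableOn.of_forall_sdiff_eq_zero ?_ measurableSet_Ioi hzero
  set C := 2 * (p * (1 + p)) * (2:ℝ) ^ (1/p) with hC
  have hC0 : 0 ≤ C := by positivity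
  refine ((integrableOn_log_rpow_div hq).const_mul (C ^ q)).mono' ?_ ?_
  · have h1 : AEMeasurable (rearr (sectionNorm p)) (volume.restrict (Ioc 0 2)) :=
      (aemeasurable_restrict_of_antitoneOn measurableSet_Ioi
        (rearr_sectionNorm_anti hp)).mono_measure (Measure.restrict_mono Ioc_subset_Ioi_self le_rfl)
    refine AEMeasurable.aestronglyMeasurable ?_
    exact (((measurable_id.pow_const (1/p)).aemeasurable.mul h1).pow_const q).div aemeasurable_id
  · refine (ae_restrict_iff' measurableSet_Ioc).2 (.of_forall fun t ht => ?_)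
    have ht0 := ht.1
    have h1 := one_le_one_sub_log (r := t/2) (by linarith) (by linarith [ht.2])
    have h2 : 0 ≤ t ^ (1/p) * rearr (sectionNorm p) t :=
      mul_nonneg (by positivity) (rearr_nonneg _ _)
    rw [Real.norm_of_nonneg (by positivity), ← mul_div_assoc, Real.rpow_neg (by linarith),
      ← Real.inv_rpow (by linarith), ← Real.mul_rpow hC0 (inv_nonneg.2 (by linarith))]
    refine div_le_div_of_nonneg_right (Real.rpow_le_rpow h2 ?_ (by linarith)) ht0.le
    exact rpow_mul_rearr_sectionNorm_le hp ht

lemma eLpNorm_min_logLogProfile :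
    eLpNorm (fun z : ℝ × ℝ => min (logLogProfile z.1) (logLogProfile z.2)) ⊤ volume = ⊤ := by
  refine ENNReal.eq_top_of_forall_nnreal_le fun M => ?_
  rw [eLpNorm_exponent_top]
  by_contra! h
  have hae := ae_lt_of_essSup_lt h
  set δ : ℝ := Real.exp (-Real.exp M) with hδ
  have hδ0 : 0 < δ := Real.exp_pos _
  have hδ1 : δ ≤ 1 := Real.exp_le_one_iff.2 (by linarith [Real.exp_pos (M:ℝ)])
  have hlarge : ∀ x ∈ Ioo 0 δ, (M:ℝ) ≤ logLogProfile x := by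
    intro x hx
    have h1 := logLogProfile_anti (y := δ) hx.1.ne' (by rw [abs_of_pos hx.1, abs_of_pos hδ0]; exact hx.2.le)
    refine le_trans ?_ h1
    rw [logLogProfile, abs_of_pos hδ0, min_eq_left hδ1, hδ, Real.log_exp, sub_neg_eq_add]
    rw [Real.le_log_iff_exp_le (by positivity)]
    linarith
  have hnull : volume (Ioo 0 δ ×ˢ Ioo 0 δ : Set (ℝ × ℝ)) = 0 := by
    refine measure_mono_null ?_ (ae_iff.1 hae)
    rintro ⟨x, y⟩ ⟨hx, hy⟩
    simp only [mem_ofPred_eq, not_lt]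
    have : (M:ℝ) ≤ min (logLogProfile x) (logLogProfile y) := le_min (hlarge x hx) (hlarge y hy)
    rw [Real.enorm_of_nonneg (M.2.trans this), ← ENNReal.ofReal_coe_nnreal]
    exact ENNReal.ofReal_le_ofReal this
  rw [Measure.volume_eq_prod, Measure.prod_prod, Real.volume_Ioo, sub_zero] at hnull
  simp [hδ0.not_ge] at hnull

/-- For `1 < p < ∞` and `1 < q < ∞` there is a measurable,
symmetric, not essentially bounded function `f` on `ℝ²` whose a.e. sections lie in
`Lip (1/p)` and whose section Lipschitz norms belong to `L^{p,q}(ℝ)`. -/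
theorem stmt12 (p q : ℝ) (hp : 1 < p) (hq : 1 < q) :
    ∃ f : ℝ × ℝ → ℝ, Measurable f ∧
      eLpNorm f ⊤ volume = ⊤ ∧
      (∀ x y : ℝ, f (x, y) = f (y, x)) ∧
      (∀ᵐ y : ℝ ∂volume, MemLip (1/p) (fun x => f (x, y))) ∧
      (∀ᵐ x : ℝ ∂volume, MemLip (1/p) (fun y => f (x, y))) ∧
      MemLorentz p q (fun y => lipNorm (1/p) (fun x => f (x, y))) ∧
      MemLorentz p q (fun x => lipNorm (1/p) (fun y => f (x, y))) := by
  have hsymm : ∀ x y : ℝ, min (logLogProfile x) (logLogProfile y)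
      = min (logLogProfile y) (logLogProfile x) := fun x y => min_comm _ _
  have hsec : (fun x => lipNorm (1/p) fun y => min (logLogProfile x) (logLogProfile y))
      = sectionNorm p := by
    ext x
    simp only [hsymm x, sectionNorm]
  refine ⟨fun z => min (logLogProfile z.1) (logLogProfile z.2),
    (measurable_logLogProfile.comp measurable_fst).min
      (measurable_logLogProfile.comp measurable_snd),
    eLpNorm_min_logLogProfile, hsymm, ?_, ?_, memLorentz_sectionNorm hp hq, ?_⟩
  · filter_upwards [volume.ae_ne (0:ℝ)] with y hy using memLip_trunc hp hy
  · filter_upwards [volume.ae_ne (0:ℝ)] with x hx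
    simpa only [hsymm x] using memLip_trunc hp hx
  · rw [hsec]
    exact memLorentz_sectionNorm hp hq

end
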